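/- arXiv:1303.1124 — 2 statements merged into one kernel-verified Lean document; each statement's English description precedes it below -/
import Mathlib

section
/- Let u, v : ℝ × ℝ → ℝ satisfy the G_2 Toda system u_{xy} = -exp(2u - v), v_{xy} = -exp(-3u + 2v). Expand (∂ - u_x)(∂ + u_x - v_x)(∂ - 2u_x + v_x) ∂ (∂ + 2u_x - v_x)(∂ - u_x + v_x)(∂ + u_x) = ∂^7 + I_1 ∂^5 + J_1 ∂^4 + J_2 ∂^3 + J_3 ∂^2 + I_2 ∂ + J_4 with ∂ = ∂_x. Then J_1 = (5/2) ∂_x I_1. -/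
noncomputable section

/-- Partial derivative in the first (x) variable. -/
def dx (f : ℝ × ℝ → ℝ) : ℝ × ℝ → ℝ := fun p => deriv (fun t => f (t, p.2)) p.1

/-- Partial derivative in the second (y) variable. -/
def dy (f : ℝ × ℝ → ℝ) : ℝ × ℝ → ℝ := fun p => deriv (fun t => f (p.1, t)) p.2

/-- Iterated x-derivative. -/
def dxIter : ℕ → (ℝ × ℝ → ℝ) → (ℝ × ℝ → ℝ)
  | 0, f => f
  | n + 1, f => dx (dxIter n f)

/-- The first-order operator `(∂ + f)` applied to `ψ`. -/
def op (f ψ : ℝ × ℝ → ℝ) : ℝ × ℝ → ℝ := fun p => dx ψ p + f p * ψ p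

/-- Composition `(∂ + f₁)(∂ + f₂)⋯(∂ + fₘ) ψ`, applying the rightmost factor first. -/
def opProd : List (ℝ × ℝ → ℝ) → (ℝ × ℝ → ℝ) → (ℝ × ℝ → ℝ)
  | [], ψ => ψ
  | f :: fs, ψ => op f (opProd fs ψ)

theorem hasDerivAt_dx {f : ℝ × ℝ → ℝ} (hf : ContDiff ℝ (⊤ : ℕ∞) f) (p : ℝ × ℝ) :
    HasDerivAt (fun t => f (t, p.2)) (dx f p) p.1 := by
  have h : ContDiff ℝ (⊤ : ℕ∞) (fun t : ℝ => f (t, p.2)) := by fun_prop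
  exact (h.differentiable (by simp) p.1).hasDerivAt

theorem dx_eq_fderiv {f : ℝ × ℝ → ℝ} (hf : ContDiff ℝ (⊤ : ℕ∞) f) :
    dx f = fun p => fderiv ℝ f p (1, 0) := by
  funext p
  have h₁ : HasFDerivAt f (fderiv ℝ f p) (p.1, p.2) :=
    (hf.differentiable (by simp) p).hasFDerivAt
  have h₂ : HasDerivAt (fun t : ℝ => (t, p.2)) (1, 0) p.1 :=
    (hasDerivAt_id p.1).prodMk (hasDerivAt_const p.1 p.2)
  exact (h₁.comp_hasDerivAt p.1 h₂).deriv

@[fun_prop]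
theorem contDiff_dx {f : ℝ × ℝ → ℝ} (hf : ContDiff ℝ (⊤ : ℕ∞) f) :
    ContDiff ℝ (⊤ : ℕ∞) (dx f) := by
  rw [dx_eq_fderiv hf]
  exact (hf.fderiv_right (m := (⊤ : ℕ∞)) (by simp)).clm_apply contDiff_const

@[fun_prop]
theorem contDiff_dxIter (n : ℕ) {f : ℝ × ℝ → ℝ} (hf : ContDiff ℝ (⊤ : ℕ∞) f) :
    ContDiff ℝ (⊤ : ℕ∞) (dxIter n f) := by
  induction n with
  | zero => exact hf
  | succ n ih => exact contDiff_dx ih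

theorem dx_const (c : ℝ) : dx (fun _ => c) = fun _ => 0 := by
  funext p
  simp [dx]

theorem dx_add {f g : ℝ × ℝ → ℝ} (hf : ContDiff ℝ (⊤ : ℕ∞) f) (hg : ContDiff ℝ (⊤ : ℕ∞) g) :
    dx (fun q => f q + g q) = fun q => dx f q + dx g q :=
  funext fun p => ((hasDerivAt_dx hf p).add (hasDerivAt_dx hg p)).deriv

theorem dx_sub {f g : ℝ × ℝ → ℝ} (hf : ContDiff ℝ (⊤ : ℕ∞) f) (hg : ContDiff ℝ (⊤ : ℕ∞) g) :
    dx (fun q => f q - g q) = fun q => dx f q - dx g q :=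
  funext fun p => ((hasDerivAt_dx hf p).sub (hasDerivAt_dx hg p)).deriv

theorem dx_neg {f : ℝ × ℝ → ℝ} (hf : ContDiff ℝ (⊤ : ℕ∞) f) :
    dx (fun q => -f q) = fun q => -dx f q :=
  funext fun p => (hasDerivAt_dx hf p).neg.deriv

theorem dx_mul {f g : ℝ × ℝ → ℝ} (hf : ContDiff ℝ (⊤ : ℕ∞) f) (hg : ContDiff ℝ (⊤ : ℕ∞) g) :
    dx (fun q => f q * g q) = fun q => dx f q * g q + f q * dx g q :=
  funext fun p => ((hasDerivAt_dx hf p).mul (hasDerivAt_dx hg p)).deriv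

theorem dx_sum {ι : Type*} (s : Finset ι) {F : ι → ℝ × ℝ → ℝ}
    (hF : ∀ i ∈ s, ContDiff ℝ (⊤ : ℕ∞) (F i)) :
    dx (fun q => ∑ i ∈ s, F i q) = fun q => ∑ i ∈ s, dx (F i) q :=
  funext fun p => (HasDerivAt.fun_sum fun i hi => hasDerivAt_dx (hF i hi) p).deriv

/-- The coefficient of `∂ ^ (m - k)` in the composition `(∂ + f₁)⋯(∂ + fₘ)`. -/
def opCoeff : List (ℝ × ℝ → ℝ) → ℕ → ℝ × ℝ → ℝ
  | [], 0 => fun _ => 1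
  | [], _ + 1 => fun _ => 0
  | _ :: fs, 0 => opCoeff fs 0
  | f :: fs, k + 1 => fun q => opCoeff fs (k + 1) q + (dx (opCoeff fs k) q + f q * opCoeff fs k q)

theorem contDiff_opCoeff {fs : List (ℝ × ℝ → ℝ)} (hfs : ∀ f ∈ fs, ContDiff ℝ (⊤ : ℕ∞) f)
    (k : ℕ) : ContDiff ℝ (⊤ : ℕ∞) (opCoeff fs k) := by
  induction fs generalizing k with
  | nil => cases k <;> exact contDiff_const
  | cons f fs ih =>
    have hf := hfs f (by simp)
    have ih' := ih fun g hg => hfs g (by simp [hg])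
    cases k with
    | zero => exact ih' 0
    | succ k => exact (ih' (k + 1)).add ((contDiff_dx (ih' k)).add (hf.mul (ih' k)))

theorem opCoeff_eq_zero {fs : List (ℝ × ℝ → ℝ)} {k : ℕ} (hk : fs.length < k) :
    opCoeff fs k = fun _ => 0 := by
  induction fs generalizing k with
  | nil =>
    obtain ⟨k, rfl⟩ := Nat.exists_eq_succ_of_ne_zero hk.ne'
    rfl
  | cons f fs ih =>
    obtain ⟨k, rfl⟩ := Nat.exists_eq_succ_of_ne_zero (Nat.ne_zero_of_lt hk)
    simp only [List.length_cons, Nat.succ_eq_add_one, Nat.add_lt_add_iff_right] at hk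
    simp [opCoeff, ih hk, ih (hk.trans (Nat.lt_succ_self k)), dx_const]

theorem opProd_eq_sum {fs : List (ℝ × ℝ → ℝ)} (hfs : ∀ f ∈ fs, ContDiff ℝ (⊤ : ℕ∞) f)
    {ψ : ℝ × ℝ → ℝ} (hψ : ContDiff ℝ (⊤ : ℕ∞) ψ) :
    opProd fs ψ = fun p =>
      ∑ ij ∈ Finset.HasAntidiagonal.antidiagonal fs.length, opCoeff fs ij.1 p * dxIter ij.2 ψ p := by
  induction fs with
  | nil => simp [opProd, opCoeff, dxIter]
  | cons f fs ih =>
    have hfs' : ∀ g ∈ fs, ContDiff ℝ (⊤ : ℕ∞) g := fun g hg => hfs g (by simp [hg])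
    have hc := contDiff_opCoeff hfs'
    have hterm (ij : ℕ × ℕ) :
        ContDiff ℝ (⊤ : ℕ∞) (fun p => opCoeff fs ij.1 p * dxIter ij.2 ψ p) :=
      (hc _).mul (contDiff_dxIter _ hψ)
    funext p
    have hshift := (Finset.Nat.sum_antidiagonal_succ (n := fs.length)
      (f := fun ij => opCoeff fs ij.1 p * dxIter ij.2 ψ p)).symm.trans
      Finset.Nat.sum_antidiagonal_succ'
    simp only [opCoeff_eq_zero (Nat.lt_succ_self fs.length), zero_mul, zero_add] at hshift
    simp only [opProd, op, ih hfs']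
    rw [dx_sum _ fun ij _ => hterm ij, List.length_cons, Finset.Nat.sum_antidiagonal_succ]
    simp only [dx_mul (hc _) (contDiff_dxIter _ hψ), opCoeff, add_mul, Finset.sum_add_distrib]
    rw [Finset.mul_sum, ← add_assoc, hshift]
    simp only [dxIter, mul_assoc]
    ring

theorem dxIter_sub_pow (c : ℝ) (k j : ℕ) :
    dxIter j (fun q => (q.1 - c) ^ k) = fun q => k.descFactorial j * (q.1 - c) ^ (k - j) := by
  induction j with
  | zero => simp [dxIter]
  | succ j ih =>
    funext p
    rw [dxIter, ih]
    have h := (((hasDerivAt_id p.1).sub_const c).pow (k - j)).const_mul (k.descFactorial j : ℝ)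
    refine h.deriv.trans ?_
    rw [Nat.descFactorial_succ]
    push_cast
    simp only [id, Nat.sub_sub]
    ring

theorem opProd_sub_pow {fs : List (ℝ × ℝ → ℝ)} (hfs : ∀ f ∈ fs, ContDiff ℝ (⊤ : ℕ∞) f)
    {k l : ℕ} (hkl : l + k = fs.length) (p : ℝ × ℝ) :
    opProd fs (fun q => (q.1 - p.1) ^ k) p = k.factorial * opCoeff fs l p := by
  rw [opProd_eq_sum hfs (by fun_prop)]
  simp only [dxIter_sub_pow, sub_self]
  rw [Finset.sum_eq_single (l, k)]
  · simp [Nat.descFactorial_self, mul_comm]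
  · rintro ⟨i, j⟩ hij hne
    have hij' : i + j = fs.length := by simpa using hij
    rcases lt_trichotomy j k with h | h | h
    · simp [Nat.sub_ne_zero_of_lt h]
    · exact absurd (Prod.ext (by lia) h) hne
    · simp [Nat.descFactorial_of_lt h]
  · simp [hkl]

/-- The factors of the `G₂` operator, in terms of `a = ∂ₓ u` and `b = ∂ₓ v`. -/
def g2Factors (a b : ℝ × ℝ → ℝ) : List (ℝ × ℝ → ℝ) :=
  [fun q => -a q, fun q => a q - b q, fun q => -2 * a q + b q, fun _ => 0,
    fun q => 2 * a q - b q, fun q => -a q + b q, fun q => a q]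

theorem contDiff_of_mem_g2Factors {a b : ℝ × ℝ → ℝ} (ha : ContDiff ℝ (⊤ : ℕ∞) a)
    (hb : ContDiff ℝ (⊤ : ℕ∞) b) : ∀ f ∈ g2Factors a b, ContDiff ℝ (⊤ : ℕ∞) f := by
  simp only [g2Factors, List.forall_mem_cons]
  refine ⟨?_, ?_, ?_, ?_, ?_, ?_, ?_, by simp⟩ <;> fun_prop

theorem opCoeff_g2Factors_three {a b : ℝ × ℝ → ℝ} (ha : ContDiff ℝ (⊤ : ℕ∞) a)
    (hb : ContDiff ℝ (⊤ : ℕ∞) b) (p : ℝ × ℝ) :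
    opCoeff (g2Factors a b) 3 p = 5 / 2 * dx (opCoeff (g2Factors a b) 2) p := by
  simp (disch := fun_prop) only [g2Factors, opCoeff, dx_const, dx_add, dx_sub, dx_neg, dx_mul,
    zero_add, add_zero, mul_one, zero_mul, mul_zero]
  ring

/-- For the G₂ Toda system, in the 7-fold operator expansion
`∂⁷ + I₁ ∂⁵ + J₁ ∂⁴ + J₂ ∂³ + J₃ ∂² + I₂ ∂ + J₄`, one has `J₁ = (5/2) ∂ₓ I₁`. -/
theorem stmt10 (u v I₁ I₂ J₁ J₂ J₃ J₄ : ℝ × ℝ → ℝ)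
    (hu : ContDiff ℝ (⊤ : ℕ∞) u) (hv : ContDiff ℝ (⊤ : ℕ∞) v)
    (hueq : ∀ p, dy (dx u) p = -Real.exp (2 * u p - v p))
    (hveq : ∀ p, dy (dx v) p = -Real.exp (-3 * u p + 2 * v p))
    (hexp : ∀ ψ : ℝ × ℝ → ℝ, ContDiff ℝ (⊤ : ℕ∞) ψ → ∀ p,
      opProd [fun q => -dx u q, fun q => dx u q - dx v q,
        fun q => -2 * dx u q + dx v q, fun _ => 0, fun q => 2 * dx u q - dx v q,
        fun q => -dx u q + dx v q, fun q => dx u q] ψ p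
        = dxIter 7 ψ p + I₁ p * dxIter 5 ψ p + J₁ p * dxIter 4 ψ p
          + J₂ p * dxIter 3 ψ p + J₃ p * dxIter 2 ψ p + I₂ p * dxIter 1 ψ p + J₄ p * ψ p) :
    ∀ p, J₁ p = 5 / 2 * dx I₁ p := by
  have ha := contDiff_dx hu
  have hb := contDiff_dx hv
  have hfs := contDiff_of_mem_g2Factors ha hb
  have hI : I₁ = opCoeff (g2Factors (dx u) (dx v)) 2 := funext fun p => by
    have h := (opProd_sub_pow hfs (k := 5) (l := 2) rfl p).symm.trans (hexp _ (by fun_prop) p)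
    simp [dxIter_sub_pow, Nat.descFactorial, Nat.factorial] at h
    linarith
  have hJ (p : ℝ × ℝ) : J₁ p = opCoeff (g2Factors (dx u) (dx v)) 3 p := by
    have h := (opProd_sub_pow hfs (k := 4) (l := 3) rfl p).symm.trans (hexp _ (by fun_prop) p)
    simp [dxIter_sub_pow, Nat.descFactorial, Nat.factorial] at h
    linarith
  intro p
  rw [hJ, hI]
  exact opCoeff_g2Factors_three ha hb p
end
end

section
/- Let g be a complex simple Lie algebra of rank n with ε = ∑_{i=1}^n e_{-α_i}, and let s ⊆ g be a subspace with g = s ⊕ [ε, g]. Then s ⊆ n (the maximal nilpotent subalgebra spanned by positive root spaces) can be chosen, and any such complement s has dimension n equal to the rank of g. -/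
open Module LieAlgebra

theorem finrank_ker_eq_of_isCompl {K V : Type*} [Field K] [AddCommGroup V] [Module K V]
    [FiniteDimensional K V] (φ : End K V) {A B C : Submodule K V} (hA : IsCompl A (B ⊔ C))
    (hBC : Disjoint B C) (hC : Disjoint (A ⊔ B) C) (hφA : A.map φ ≤ A ⊔ B)
    (hφBC : (B ⊔ C).map φ ≤ C)
    (hker : Disjoint A (LinearMap.ker φ)) (hrange : C ≤ LinearMap.range φ) :
    finrank K (LinearMap.ker φ) = finrank K B := by
  have e1 := Submodule.finrank_add_eq_of_isCompl hA
  have e2 := Submodule.finrank_sup_add_finrank_inf_eq B C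
  rw [hBC.eq_bot, finrank_bot] at e2
  have e3 := φ.finrank_range_add_finrank_ker
  have e4 := (φ.domRestrict (B ⊔ C)).finrank_range_add_finrank_ker
  rw [LinearMap.range_domRestrict] at e4
  have e5 := Submodule.finrank_mono hφBC
  have e6 : finrank K (LinearMap.ker (φ.domRestrict (B ⊔ C))) ≤ finrank K (LinearMap.ker φ) := by
    rw [LinearMap.ker_domRestrict]
    exact (Submodule.equivSubtypeMap _ _).finrank_eq.trans_le
      (Submodule.finrank_mono (Submodule.map_comap_le _ _))
  have e7 : finrank K (A.map φ) = finrank K A := by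
    have := (φ.domRestrict A).finrank_range_add_finrank_ker
    rwa [LinearMap.range_domRestrict, LinearMap.ker_domRestrict,
      Submodule.disjoint_iff_comap_eq_bot.mp hker, finrank_bot] at this
  have e8 := Submodule.finrank_sup_add_finrank_inf_eq (A.map φ) C
  rw [(hC.mono_left hφA).eq_bot, finrank_bot] at e8
  have e9 := Submodule.finrank_mono (sup_le (LinearMap.map_le_range (f := φ) (p := A)) hrange)
  lia

theorem ker_toEnd_le_iSup_eigenspace {K L M : Type*} [Field K] [CharZero K] [LieRing L]
    [LieAlgebra K L] [AddCommGroup M] [Module K M] [LieRingModule L M] [LieModule K L M]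
    [FiniteDimensional K M] {h e f : L} (t : IsSl2Triple h e f)
    (hh : ⨆ μ, (LieModule.toEnd K L M h).eigenspace μ = ⊤) :
    LinearMap.ker (LieModule.toEnd K L M e) ≤
      ⨆ k : ℕ, (LieModule.toEnd K L M h).eigenspace (k : K) := by
  have hker : ∀ x ∈ LinearMap.ker (LieModule.toEnd K L M e),
      LieModule.toEnd K L M h x ∈ LinearMap.ker (LieModule.toEnd K L M e) := by
    intro x hx
    simp only [LinearMap.mem_ker, LieModule.toEnd_apply_apply] at hx ⊢
    rw [leibniz_lie, hx, lie_zero, add_zero, ← lie_skew, t.lie_h_e_nsmul, neg_lie, nsmul_lie, hx]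
    simp
  have key := Submodule.inf_iSup_genEigenspace hker 1
  rw [← inf_top_eq (LinearMap.ker _), ← hh]
  refine key.le.trans (iSup_le fun μ x hx ↦ ?_)
  obtain ⟨hxe, hxh⟩ := hx
  rcases eq_or_ne x 0 with rfl | hx0
  · exact zero_mem _
  have P : t.HasPrimitiveVectorWith x μ :=
    ⟨hx0, by simpa using Module.End.mem_eigenspace_iff.mp hxh, by simpa using hxe⟩
  obtain ⟨k, rfl⟩ := P.exists_nat
  exact Submodule.mem_iSup_of_mem k hxh

theorem mem_range_ad_of_mem_eigenspace {K L : Type*} [Field K] [CharZero K] [LieRing L]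
    [LieAlgebra K L] [FiniteDimensional K L] [IsKilling K L] {h e f : L} (t : IsSl2Triple h e f)
    (hh : ⨆ μ, (ad K L h).eigenspace μ = ⊤) {c : K} (hc : ∀ k : ℕ, c ≠ -k) {y : L}
    (hy : y ∈ (ad K L h).eigenspace c) : y ∈ LinearMap.range (ad K L e) := by
  have hrefl : (killingForm K L).IsRefl := (LieModule.traceForm_isSymm K L L).isRefl
  rw [← LinearMap.BilinForm.orthogonal_orthogonal (IsKilling.killingForm_nondegenerate K L) hrefl
    (LinearMap.range (ad K L e)), LinearMap.BilinForm.mem_orthogonal_iff]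
  intro x hx
  have hxe : x ∈ LinearMap.ker (LieModule.toEnd K L L e) := by
    rw [LinearMap.mem_ker, ← Submodule.mem_bot K, ← IsKilling.ker_killingForm_eq_bot K L,
      LinearMap.mem_ker]
    ext z
    have h1 := hx _ ⟨z, rfl⟩
    have h2 := LieModule.traceForm_apply_lie_apply K L L x e z
    rw [hrefl.eq_iff] at h1
    rw [LieModule.toEnd_apply_apply, ← lie_skew, map_neg, LinearMap.neg_apply, h2]
    simpa using h1
  have hx' := ker_toEnd_le_iSup_eigenspace t hh hxe
  clear hxe hx
  induction hx' using Submodule.iSup_induction' with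
  | zero => simp
  | add a b _ _ ha hb => simp_all
  | mem k x hx =>
    have hx1 : ⁅h, x⁆ = (k : K) • x := by simpa using Module.End.mem_eigenspace_iff.mp hx
    have hy1 : ⁅h, y⁆ = c • y := by simpa using Module.End.mem_eigenspace_iff.mp hy
    have h3 := LieModule.traceForm_apply_lie_apply K L L x h y
    rw [← lie_skew, hx1, hy1, map_neg, map_smul, map_smul, LinearMap.neg_apply,
      LinearMap.smul_apply, smul_eq_mul, smul_eq_mul] at h3
    have h4 : (c + k) * killingForm K L x y = 0 := by linear_combination -h3
    exact (mul_eq_zero.mp h4).resolve_left fun h5 ↦ hc k (eq_neg_of_add_eq_zero_left h5)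

theorem finrank_ker_ad_eq {K L : Type*} [Field K] [CharZero K] [LieRing L]
    [LieAlgebra K L] [FiniteDimensional K L] [IsKilling K L] {h e f : L} (t : IsSl2Triple h e f)
    (hh : ⨆ k : ℤ, (ad K L h).eigenspace (2 * k : K) = ⊤) :
    finrank K (LinearMap.ker (ad K L e)) = finrank K ((ad K L h).eigenspace 0) := by
  have hh' : ⨆ μ, (ad K L h).eigenspace μ = ⊤ :=
    eq_top_iff.mpr (hh.ge.trans (iSup_le fun k ↦ le_iSup (ad K L h).eigenspace (2 * k : K)))
  have hind : iSupIndep fun k : ℤ ↦ (ad K L h).eigenspace (2 * k : K) :=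
    (ad K L h).eigenspaces_iSupIndep.comp fun a b hab ↦ by simpa using hab
  have hmap (S T : Set ℤ) (hST : ∀ k ∈ S, k + 1 ∈ T) :
      (⨆ k ∈ S, (ad K L h).eigenspace (2 * k : K)).map (ad K L e) ≤
        ⨆ k ∈ T, (ad K L h).eigenspace (2 * k : K) := by
    simp only [Submodule.map_iSup, iSup_le_iff, Submodule.map_le_iff_le_comap]
    intro k hk x hx
    refine Submodule.mem_iSup_of_mem (k + 1) (Submodule.mem_iSup_of_mem (hST k hk) ?_)
    rw [Module.End.mem_eigenspace_iff, ad_apply] at hx ⊢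
    rw [ad_apply, leibniz_lie, hx, t.lie_h_e_smul K, smul_lie, lie_smul, ← add_smul]
    congr 1
    push_cast
    ring
  have hzero : (ad K L h).eigenspace 0 =
      ⨆ k ∈ ({0} : Set ℤ), (ad K L h).eigenspace (2 * k : K) := by simp
  rw [hzero]
  apply finrank_ker_eq_of_isCompl (A := ⨆ k ∈ Set.Iio (0 : ℤ), (ad K L h).eigenspace (2 * k : K))
    (C := ⨆ k ∈ Set.Ioi (0 : ℤ), (ad K L h).eigenspace (2 * k : K))
  · rw [← iSup_union]
    refine ⟨hind.disjoint_biSup_biSup ?_, ?_⟩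
    · simp [Set.disjoint_left]
    · rw [codisjoint_iff, ← iSup_union, ← hh]
      refine iSup_congr fun k ↦ iSup_pos ?_
      simp only [Set.mem_union, Set.mem_Iio, Set.mem_singleton_iff, Set.mem_Ioi]
      lia
  · refine hind.disjoint_biSup_biSup (by simp)
  · rw [← iSup_union]
    refine hind.disjoint_biSup_biSup ?_
    simp [Set.disjoint_left]
  · rw [← iSup_union]
    exact hmap _ _ (by simp)
  · rw [← iSup_union]
    exact hmap _ _ (by simp)
  · refine Disjoint.mono_right (ker_toEnd_le_iSup_eigenspace t hh') ?_
    have := (ad K L h).eigenspaces_iSupIndep.disjoint_biSup_biSup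
      (s := (fun k : ℤ ↦ (2 * k : K)) '' Set.Iio 0) (t := Set.range (Nat.cast : ℕ → K)) ?_
    · rw [iSup_image, iSup_range] at this
      exact this
    · rw [Set.disjoint_left]
      rintro _ ⟨k, hk, rfl⟩ ⟨m, hm⟩
      have : (m : ℤ) = 2 * k := by
        apply Int.cast_injective (α := K)
        simpa using hm
      simp at hk
      lia
  · refine iSup₂_le fun k hk y hy ↦ mem_range_ad_of_mem_eigenspace t hh' (fun m hm ↦ ?_) hy
    have : 2 * k = - (m : ℤ) := by exact_mod_cast hm
    simp at hk
    lia

theorem exists_mem_rootSpace_lie_eq {K L : Type*} [Field K] [CharZero K] [LieRing L]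
    [LieAlgebra K L] [FiniteDimensional K L] [IsKilling K L] {H : LieSubalgebra K L}
    [H.IsCartanSubalgebra] [LieModule.IsTriangularizable K H L] {α : Dual K H} {e : L}
    (he : e ∈ rootSpace H (-α)) (he0 : e ≠ 0) :
    ∃ f ∈ rootSpace H α, ⁅e, f⁆ = (IsKilling.cartanEquivDual H).symm α := by
  obtain ⟨f, hf, hef⟩ : ∃ f ∈ rootSpace H α, killingForm K L e f ≠ 0 := by
    by_contra! hcon
    refine he0 ?_
    have := mem_ker_killingForm_of_mem_rootSpace_of_forall_rootSpace_neg K L H he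
      (by simpa using hcon)
    simpa using this
  let β : LieModule.Weight K H L := ⟨-α, fun h ↦ he0 (by simpa [h] using he)⟩
  have h1 := IsKilling.lie_eq_killingForm_smul_of_mem_rootSpace_of_mem_rootSpace_neg
    (α := β) he (f := f) (by simpa [β] using hf)
  have hβ : (β.toLinear : Dual K H) = -α := by ext; rfl
  rw [hβ] at h1
  refine ⟨-(killingForm K L e f)⁻¹ • f, Submodule.smul_mem _ _ hf, ?_⟩
  rw [lie_smul, h1, smul_smul]
  simp [hef]

theorem exists_lie_sum_eq {K L ι : Type*} [Field K] [CharZero K] [LieRing L]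
    [LieAlgebra K L] [FiniteDimensional K L] [IsKilling K L] {H : LieSubalgebra K L}
    [H.IsCartanSubalgebra] [LieModule.IsTriangularizable K H L] [Fintype ι] {α : ι → Dual K H}
    (hspan : Submodule.span K (Set.range α) = ⊤)
    (hα : ∀ i j, i ≠ j → rootSpace H (α i - α j) = ⊥) {e : ι → L}
    (he : ∀ i, e i ∈ rootSpace H (-α i)) (he0 : ∀ i, e i ≠ 0) (x : H) :
    ∃ f ∈ ⨆ i, (rootSpace H (α i)).toSubmodule, ⁅∑ i, e i, f⁆ = x := by
  choose f hf hef using fun i ↦ exists_mem_rootSpace_lie_eq (he i) (he0 i)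
  have hsum (j : ι) : ⁅∑ i, e i, f j⁆ = (IsKilling.cartanEquivDual H).symm (α j) := by
    rw [sum_lie, Finset.sum_eq_single j _ (by simp), hef]
    intro i _ hij
    have := lie_mem_genWeightSpace_of_mem_genWeightSpace (he i) (hf j)
    rw [neg_add_eq_sub] at this
    simpa [rootSpace, hα j i hij.symm] using this
  obtain ⟨c, hc⟩ := (Submodule.mem_span_range_iff_exists_fun K).mp
    (hspan.ge (Submodule.mem_top (x := IsKilling.cartanEquivDual H x)))
  refine ⟨∑ i, c i • f i, Submodule.sum_mem _ fun i _ ↦ Submodule.smul_mem _ _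
    (Submodule.mem_iSup_of_mem i (hf i)), ?_⟩
  simp only [lie_sum, lie_smul, hsum]
  have := congrArg (IsKilling.cartanEquivDual H).symm hc
  rw [map_sum, LinearEquiv.symm_apply_apply] at this
  rw [← this]
  simp

theorem ad_eigenspace_zero_eq {K L : Type*} [Field K] [CharZero K] [LieRing L]
    [LieAlgebra K L] [FiniteDimensional K L] [IsKilling K L] {H : LieSubalgebra K L}
    [H.IsCartanSubalgebra] [LieModule.IsTriangularizable K H L] {h : H}
    (hh : ∀ χ : LieModule.Weight K H L, χ h = 0 → χ.IsZero) :
    (ad K L (h : L)).eigenspace 0 = H.toSubmodule := by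
  apply le_antisymm
  · have h1 := LieModule.eq_iSup_inf_genWeightSpace K H L (LieModule.genWeightSpaceOf L (0 : K) h)
    have h2 : (ad K L (h : L)).eigenspace 0 ≤
        (LieModule.genWeightSpaceOf L (0 : K) h).toSubmodule :=
      Module.End.genEigenspace_le_maximal _ _ _
    refine h2.trans ?_
    rw [h1, ← LieSubalgebra.coe_toLieSubmodule, LieSubmodule.toSubmodule_le_toSubmodule,
      ← rootSpace_zero_eq]
    refine iSup_le fun χ ↦ ?_
    by_cases hχ : χ h = 0
    · rw [← (hh χ hχ).eq]
      exact inf_le_right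
    · refine le_trans (le_of_eq ?_) bot_le
      rw [eq_bot_iff]
      rintro x ⟨hx0, hx⟩
      have := (Module.End.disjoint_genEigenspace (LieModule.toEnd K H L h) hχ ⊤ ⊤).symm
      exact (Submodule.disjoint_def.mp this) x hx0
        (LieModule.genWeightSpace_le_genWeightSpaceOf L h χ hx)
  · intro x hx
    rw [Module.End.mem_eigenspace_iff, zero_smul, ad_apply]
    exact congrArg Subtype.val (trivial_lie_zero H H h ⟨x, hx⟩)

theorem not_sub_eq_sum_nat {K V ι : Type*} [Field K] [CharZero K] [AddCommGroup V] [Module K V]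
    [Fintype ι] {α : ι → V} (hα : LinearIndependent K α) {i j : ι} (hij : i ≠ j) (c : ι → ℕ) :
    α i - α j ≠ ∑ k, (c k : K) • α k := by
  classical
  intro h
  have h1 : ∑ k, ((c k : K) - (Pi.single i 1 : ι → K) k + (Pi.single j 1 : ι → K) k) • α k = 0 := by
    simp only [add_smul, sub_smul, Finset.sum_add_distrib, Finset.sum_sub_distrib, ← h]
    simp [Pi.single_apply]
  have h2 := Fintype.linearIndependent_iff.mp hα _ h1 j
  simp [hij.symm] at h2
  norm_cast at h2

/-- Kostant slice: Let `g` be a complex simple Lie algebra of rank `n`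
(with `n` simple roots `αs`), and `ε = ∑ᵢ e_{-αᵢ}` the principal nilpotent element.
Then a complement `s` of `[ε, g] = range (ad ε)` can be chosen inside the maximal
nilpotent subalgebra `nn = ⊕_{α > 0} g_α`, and any complement of `[ε, g]` has
dimension `n`, the rank of `g`. -/
theorem stmt14 (g : Type*) [LieRing g] [LieAlgebra ℂ g] [FiniteDimensional ℂ g]
    [LieAlgebra.IsSimple ℂ g]
    (H : LieSubalgebra ℂ g) [H.IsCartanSubalgebra]
    (Δ : Set (Module.Dual ℂ H))
    (hΔ : ∀ α : Module.Dual ℂ H, α ∈ Δ ↔ α ≠ 0 ∧ LieAlgebra.rootSpace H ⇑α ≠ ⊥)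
    -- the simple roots; their number `n` is the rank of `g`
    (n : ℕ) (hrank : n = Module.finrank ℂ H)
    (αs : Fin n → Module.Dual ℂ H) (hαs : ∀ i, αs i ∈ Δ)
    (pos : Module.Dual ℂ H → Prop)
    (hpos : ∀ α ∈ Δ, (pos α ↔ ∃ c : Fin n → ℕ, α = ∑ i, (c i : ℂ) • αs i))
    (hposneg : ∀ α ∈ Δ, pos α ∨ pos (-α))
    (e : Fin n → g) (he : ∀ i, e i ∈ LieAlgebra.rootSpace H ⇑(-(αs i)))
    (hene : ∀ i, e i ≠ 0)
    (ε : g) (hε : ε = ∑ i, e i)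
    (nn : Submodule ℂ g)
    (hnn : nn = ⨆ α ∈ {α ∈ Δ | pos α}, (LieAlgebra.rootSpace H ⇑α : LieSubmodule ℂ H g).toSubmodule) :
    (∃ s : Submodule ℂ g,
        IsCompl s (LinearMap.range (LieAlgebra.ad ℂ g ε)) ∧ s ≤ nn) ∧
      ∀ s : Submodule ℂ g,
        IsCompl s (LinearMap.range (LieAlgebra.ad ℂ g ε)) → Module.finrank ℂ s = n := by
  have hΔW (χ : LieModule.Weight ℂ H g) (hχ : ¬ χ.IsZero) : χ.toLinear ∈ Δ :=
    (hΔ _).mpr ⟨fun h ↦ hχ (by ext x; exact LinearMap.congr_fun h x), χ.genWeightSpace_ne_bot⟩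
  have hcomb (χ : LieModule.Weight ℂ H g) (hχ : ¬ χ.IsZero) : ∃ c : Fin n → ℕ,
      (pos χ.toLinear ∧ χ.toLinear = ∑ i, (c i : ℂ) • αs i) ∨
        -χ.toLinear = ∑ i, (c i : ℂ) • αs i := by
    rcases hposneg _ (hΔW χ hχ) with h | h
    · obtain ⟨c, hc⟩ := (hpos _ (hΔW χ hχ)).mp h
      exact ⟨c, Or.inl ⟨h, hc⟩⟩
    · obtain ⟨c, hc⟩ := (hpos _ (hΔW (-χ) (by simpa using hχ))).mp h
      exact ⟨c, Or.inr hc⟩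
  have hspan : Submodule.span ℂ (Set.range αs) = ⊤ := by
    rw [eq_top_iff, ← IsKilling.span_weight_isNonZero_eq_top ℂ g H, Submodule.span_le]
    rintro _ ⟨χ, hχ, rfl⟩
    have hmem (c : Fin n → ℕ) :
        ∑ i, (c i : ℂ) • αs i ∈ Submodule.span ℂ (Set.range αs) :=
      Submodule.sum_mem _ fun i _ ↦ Submodule.smul_mem _ _ (Submodule.subset_span ⟨i, rfl⟩)
    obtain ⟨c, ⟨-, h⟩ | h⟩ := hcomb χ hχ
    · exact h ▸ hmem c
    · exact (Submodule.neg_mem_iff _).mp (h ▸ hmem c)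
  have hli : LinearIndependent ℂ αs :=
    linearIndependent_of_top_le_span_of_card_eq_finrank hspan.ge
      (by rw [Fintype.card_fin, hrank, Subspace.dual_finrank_eq])
  have hdiff (i j : Fin n) (hij : i ≠ j) : rootSpace H (αs i - αs j) = ⊥ := by
    by_contra hne
    let χ : LieModule.Weight ℂ H g := ⟨αs i - αs j, hne⟩
    have hχ : χ.toLinear = αs i - αs j := by ext; rfl
    have hχ0 : ¬ χ.IsZero := fun h ↦ hij <| hli.injective <| sub_eq_zero.mp <| by
      rw [← hχ]
      ext x
      exact congrFun h x
    obtain ⟨c, ⟨-, h⟩ | h⟩ := hcomb χ hχ0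
    · exact not_sub_eq_sum_nat hli hij c (hχ ▸ h)
    · exact not_sub_eq_sum_nat hli hij.symm c (by rw [← h, hχ, neg_sub])
  obtain ⟨h, hh⟩ : ∃ h : H, ∀ i, αs i h = -2 := by
    let b := Module.Basis.mk hli hspan.ge
    refine ⟨(Module.evalEquiv ℂ H).symm (b.constr ℂ fun _ ↦ (-2 : ℂ)), fun i ↦ ?_⟩
    rw [Module.apply_evalEquiv_symm_apply]
    simpa [b] using b.constr_basis ℂ (fun _ ↦ (-2 : ℂ)) i
  have hcomb_h (c : Fin n → ℕ) :
      (∑ i, (c i : ℂ) • αs i) h = 2 * ((-∑ i, (c i : ℤ) : ℤ) : ℂ) := by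
    simp [hh, Finset.mul_sum, mul_comm]
  have hcomb_pos {c : Fin n → ℕ} (hc : ∑ i, (c i : ℂ) • αs i ≠ 0) : 0 < ∑ i, (c i : ℤ) := by
    refine lt_of_le_of_ne (by positivity) fun h0 ↦ hc ?_
    rw [eq_comm, Finset.sum_eq_zero_iff_of_nonneg (by simp)] at h0
    exact Finset.sum_eq_zero fun i hi ↦ by simpa using Or.inl (h0 i hi)
  have hdeg (χ : LieModule.Weight ℂ H g) (hχ : ¬ χ.IsZero) :
      ∃ k : ℤ, χ h = 2 * k ∧ k ≠ 0 ∧ (k < 0 → pos χ.toLinear) := by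
    have hχ0 : χ.toLinear ≠ 0 := fun h ↦ hχ (by ext x; exact LinearMap.congr_fun h x)
    obtain ⟨c, ⟨hp, hc⟩ | hc⟩ := hcomb χ hχ
    · have := hcomb_pos (hc ▸ hχ0)
      exact ⟨_, (LinearMap.congr_fun hc h).trans (hcomb_h c), by lia, fun _ ↦ hp⟩
    · have := hcomb_pos (hc ▸ neg_ne_zero.mpr hχ0)
      refine ⟨∑ i, (c i : ℤ), ?_, by lia, by lia⟩
      have h1 := (LinearMap.congr_fun hc h).trans (hcomb_h c)
      have h2 : -χ h = 2 * ((-∑ i, (c i : ℤ) : ℤ) : ℂ) := h1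
      push_cast at h2 ⊢
      linear_combination -h2
  have hE0 : (ad ℂ g (h : g)).eigenspace 0 = H.toSubmodule := by
    refine ad_eigenspace_zero_eq fun χ hχ ↦ ?_
    by_contra hχ0
    obtain ⟨k, hk, hk0, -⟩ := hdeg χ hχ0
    rw [hk] at hχ
    simp [hk0] at hχ
  have hE (χ : LieModule.Weight ℂ H g) :
      (rootSpace H χ).toSubmodule ≤ (ad ℂ g (h : g)).eigenspace (χ h) := fun x hx ↦
    Module.End.mem_eigenspace_iff.mpr (IsKilling.lie_eq_smul_of_mem_rootSpace hx h)
  have htop : ⨆ χ : LieModule.Weight ℂ H g, (rootSpace H χ).toSubmodule = ⊤ := by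
    rw [← LieSubmodule.iSup_toSubmodule, LieModule.iSup_genWeightSpace_eq_top' ℂ H g,
      LieSubmodule.top_toSubmodule]
  have hEtop : ⨆ k : ℤ, (ad ℂ g (h : g)).eigenspace (2 * k : ℂ) = ⊤ := by
    refine eq_top_iff.mpr (htop.ge.trans (iSup_le fun χ ↦ (hE χ).trans ?_))
    by_cases hχ : χ.IsZero
    · exact le_iSup_of_le 0 (by rw [hχ.eq]; simp)
    · obtain ⟨k, hk, -⟩ := hdeg χ hχ
      exact le_iSup_of_le k (by rw [hk])
  have hh0 : (h : g) ≠ 0 := by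
    intro h0
    have hn : n = 0 := by
      by_contra hn
      have h1 := hh ⟨0, Nat.pos_of_ne_zero hn⟩
      rw [show h = 0 from Subtype.ext h0, map_zero] at h1
      norm_num at h1
    have hHtop : H.toSubmodule = ⊤ := by
      rw [← hE0, h0, map_zero, eq_top_iff]
      intro x _
      simp
    have h2 : finrank ℂ g = 0 := by
      rw [← finrank_top ℂ g, ← hHtop, ← hn, hrank]
      rfl
    have := finrank_zero_iff.mp h2
    exact LieAlgebra.IsSimple.non_abelian ℂ (L := g) ⟨fun _ _ ↦ Subsingleton.elim _ _⟩
  obtain ⟨f, hf, hεf⟩ := exists_lie_sum_eq hspan hdiff he hene h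
  rw [← hε] at hεf
  have hhε : ⁅(h : g), ε⁆ = 2 • ε := by
    rw [hε, lie_sum, Finset.smul_sum]
    refine Finset.sum_congr rfl fun i _ ↦ ?_
    refine (IsKilling.lie_eq_smul_of_mem_rootSpace (he i) h).trans ?_
    simp [hh, two_smul]
  have hhf : ⁅(h : g), f⁆ = -(2 • f) := by
    have hle : ⨆ i, (rootSpace H (αs i)).toSubmodule ≤ (ad ℂ g (h : g)).eigenspace (-2) :=
      iSup_le fun i x hx ↦ Module.End.mem_eigenspace_iff.mpr <| by
        rw [← hh i]
        exact IsKilling.lie_eq_smul_of_mem_rootSpace hx h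
    simpa [two_smul] using Module.End.mem_eigenspace_iff.mp (hle hf)
  have t : IsSl2Triple (h : g) ε f := ⟨hh0, hεf, hhε, hhf⟩
  have hE' : ⨆ μ, (ad ℂ g (h : g)).eigenspace μ = ⊤ :=
    eq_top_iff.mpr (hEtop.ge.trans (iSup_le fun k ↦ le_iSup _ (2 * k : ℂ)))
  have hsup : LinearMap.range (ad ℂ g ε) ⊔ nn = ⊤ := by
    refine eq_top_iff.mpr (htop.ge.trans (iSup_le fun χ ↦ ?_))
    by_cases hχ : χ.IsZero
    · refine le_sup_of_le_left fun x hx ↦ ?_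
      rw [hχ.eq, rootSpace_zero_eq, LieSubalgebra.coe_toLieSubmodule] at hx
      obtain ⟨z, -, hz⟩ := exists_lie_sum_eq hspan hdiff he hene ⟨x, hx⟩
      exact ⟨z, by rw [ad_apply, hε, hz]⟩
    · obtain ⟨k, hk, hk0, hkpos⟩ := hdeg χ hχ
      rcases hk0.lt_or_gt with hk1 | hk1
      · rw [hnn]
        exact le_sup_of_le_right (le_iSup₂_of_le χ.toLinear ⟨hΔW χ hχ, hkpos hk1⟩ le_rfl)
      · refine le_sup_of_le_left fun x hx ↦
          mem_range_ad_of_mem_eigenspace t hE' (fun m hm ↦ ?_) (hE χ hx)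
        rw [hk] at hm
        have : 2 * k = -(m : ℤ) := by exact_mod_cast hm
        lia
  refine ⟨?_, fun s hs ↦ ?_⟩
  · obtain ⟨s, hs, hs'⟩ := IsModularLattice.exists_disjoint_and_sup_eq
      (inf_le_right : LinearMap.range (ad ℂ g ε) ⊓ nn ≤ nn)
    have hsn : s ≤ nn := hs' ▸ le_sup_right
    refine ⟨s, ⟨?_, ?_⟩, hsn⟩
    · rw [disjoint_iff, eq_bot_iff, ← hs.eq_bot]
      exact le_inf (le_inf inf_le_right (inf_le_left.trans hsn)) inf_le_left
    · rw [codisjoint_iff, eq_top_iff, ← hsup, ← hs', ← sup_assoc]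
      exact sup_le (sup_le le_sup_right (inf_le_left.trans le_sup_right)) le_sup_left
  · have h1 := Submodule.finrank_add_eq_of_isCompl hs
    have h2 := (ad ℂ g ε).finrank_range_add_finrank_ker
    have h3 := finrank_ker_ad_eq t hEtop
    rw [hE0] at h3
    refine (Nat.add_right_cancel (h1.trans ?_)).trans (h3.trans hrank.symm)
    rw [← h2, add_comm]
end
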